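/- Let (X, m) be a measure space, let μ ≥ 0, λ₀ ≥ 0, γ ≥ 0, K > 0 be real numbers, and let n : X → ℝ³, ε : X → (symmetric real 3×3 matrices), κ : X → (real 3×3 matrices) be measurable fields such that for m-a.e. x: ‖n(x)‖ = 1, ε(x)·n(x) = 0, and ‖κ(x)‖ ≤ K (Frobenius norm). Define σ(x) := 2μ·ε(x) + λ₀·(tr ε(x))·(I − n(x)⊗n(x)). Assume x ↦ σ(x) : ε(x) and x ↦ (σ(x) : κ(x))² are integrable. Then ∫_X σ : ε dm − γ·∫_X (σ : κ)² dm ≥ (1 − 2γ·K²·(μ + λ₀))·∫_X σ : ε dm. -/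

import Mathlib

open Matrix MeasureTheory

/-- The Frobenius (double-dot) product `A : B := Σ_{i,j} A_{ij}·B_{ij}`. -/
def frob (A B : Matrix (Fin 3) (Fin 3) ℝ) : ℝ := ∑ i, ∑ j, A i j * B i j

theorem frob_cs (A B : Matrix (Fin 3) (Fin 3) ℝ) :
    (frob A B) ^ 2 ≤ frob A A * frob B B := by
  have h := Finset.sum_mul_sq_le_sq_mul_sq (Finset.univ : Finset (Fin 3 × Fin 3))
    (fun p => A p.1 p.2) (fun p => B p.1 p.2)
  simp only [Fintype.sum_prod_type, pow_two] at h
  simpa only [frob, pow_two] using h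

theorem frob_comb (a b : ℝ) (A B C : Matrix (Fin 3) (Fin 3) ℝ) :
    frob (a • A + b • B) C = a * frob A C + b * frob B C := by
  simp only [frob, Fin.sum_univ_three, Matrix.add_apply, Matrix.smul_apply, smul_eq_mul]
  ring

theorem frob_symm (A B : Matrix (Fin 3) (Fin 3) ℝ) : frob A B = frob B A := by
  simp only [frob, mul_comm]

theorem frob_proj (v : Fin 3 → ℝ) (A : Matrix (Fin 3) (Fin 3) ℝ) :
    frob (1 - vecMulVec v v) A = A.trace - v ⬝ᵥ (A.mulVec v) := by
  simp [frob, Fin.sum_univ_three, Matrix.trace, Matrix.mulVec, dotProduct, vecMulVec_apply,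
    Matrix.one_apply]
  ring

theorem frob_proj_self (v : Fin 3 → ℝ) (h : v ⬝ᵥ v = 1) :
    frob (1 - vecMulVec v v) (1 - vecMulVec v v) = 2 := by
  have e : frob (1 - vecMulVec v v) (1 - vecMulVec v v)
      = 3 - 2 * (v ⬝ᵥ v) + (v ⬝ᵥ v) ^ 2 := by
    simp [frob, Fin.sum_univ_three, dotProduct, vecMulVec_apply, Matrix.one_apply]
    ring
  rw [e, h]; norm_num

theorem pointwise_bound (μ l K : ℝ) (hμ : 0 ≤ μ) (hl : 0 ≤ l)
    (v : Fin 3 → ℝ) (e k : Matrix (Fin 3) (Fin 3) ℝ)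
    (hv : Real.sqrt (v ⬝ᵥ v) = 1) (hev : e.mulVec v = 0)
    (hk : Real.sqrt (frob k k) ≤ K) (s : Matrix (Fin 3) (Fin 3) ℝ)
    (hs : s = (2 * μ) • e + (l * e.trace) • (1 - vecMulVec v v)) :
    (frob s k) ^ 2 ≤ 2 * K ^ 2 * (μ + l) * frob s e := by
  have hv' : v ⬝ᵥ v = 1 := by simpa using hv
  have hPP := frob_proj_self v hv'
  have hPe : frob (1 - vecMulVec v v) e = e.trace := by simp [frob_proj, hev]
  have hcs := frob_cs (1 - vecMulVec v v) e
  rw [hPP, hPe] at hcs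
  have hse : frob s e = 2 * μ * frob e e + l * e.trace ^ 2 := by
    rw [hs, frob_comb, hPe]; ring
  have hsP : frob s (1 - vecMulVec v v) = 2 * μ * e.trace + 2 * l * e.trace := by
    rw [hs, frob_comb, hPP, frob_symm e, hPe]; ring
  have hss : frob s s = 2 * μ * frob s e + l * e.trace * frob s (1 - vecMulVec v v) := by
    conv_lhs => rw [frob_symm]; arg 1; rw [hs]
    rw [frob_comb, frob_symm e, frob_symm _ s]
  have h1 : frob s s ≤ 2 * (μ + l) * frob s e := by
    rw [hss, hsP, hse]
    nlinarith [mul_nonneg (mul_nonneg hμ hl) (sub_nonneg.2 hcs)]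
  have hs0 : 0 ≤ frob s s :=
    Finset.sum_nonneg fun i _ => Finset.sum_nonneg fun j _ => mul_self_nonneg _
  have hkk : frob k k ≤ K ^ 2 := (Real.sqrt_le_iff.1 hk).2
  calc (frob s k) ^ 2 ≤ frob s s * frob k k := frob_cs s k
    _ ≤ frob s s * K ^ 2 := mul_le_mul_of_nonneg_left hkk hs0
    _ ≤ 2 * (μ + l) * frob s e * K ^ 2 := mul_le_mul_of_nonneg_right h1 (sq_nonneg K)
    _ = _ := by ring

/-- Integrated coercivity estimate: with measurable fields
`n, ε, κ` on a measure space `(X, m)` such that a.e. `‖n(x)‖ = 1`, `ε(x)` is symmetric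
with `ε(x)·n(x) = 0`, `‖κ(x)‖_F ≤ K`, and with
`σ(x) := 2μ·ε(x) + λ₀·tr(ε(x))·(I − n(x)⊗n(x))`, if `x ↦ σ:ε` and `x ↦ (σ:κ)²` are
integrable then
`∫ σ:ε dm − γ·∫ (σ:κ)² dm ≥ (1 − 2γK²(μ+λ₀))·∫ σ:ε dm`. -/
theorem integrated_coercivity {X : Type*} [MeasurableSpace X] (m : Measure X)
    (μ lam₀ γ K : ℝ) (hμ : 0 ≤ μ) (hlam : 0 ≤ lam₀) (hγ : 0 ≤ γ) (hK : 0 < K)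
    (n : X → Fin 3 → ℝ) (ε κ : X → Matrix (Fin 3) (Fin 3) ℝ)
    (hn_meas : Measurable n) (hε_meas : Measurable fun x i j => ε x i j)
    (hκ_meas : Measurable fun x i j => κ x i j)
    (hn : ∀ᵐ x ∂m, Real.sqrt (n x ⬝ᵥ n x) = 1)
    (hε_symm : ∀ᵐ x ∂m, (ε x).IsSymm)
    (hεn : ∀ᵐ x ∂m, (ε x).mulVec (n x) = 0)
    (hκ : ∀ᵐ x ∂m, Real.sqrt (frob (κ x) (κ x)) ≤ K)
    (σ : X → Matrix (Fin 3) (Fin 3) ℝ)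
    (hσ : ∀ x, σ x = (2 * μ) • ε x + (lam₀ * (ε x).trace) • (1 - vecMulVec (n x) (n x)))
    (hint₁ : Integrable (fun x => frob (σ x) (ε x)) m)
    (hint₂ : Integrable (fun x => (frob (σ x) (κ x)) ^ 2) m) :
    ∫ x, frob (σ x) (ε x) ∂m - γ * ∫ x, (frob (σ x) (κ x)) ^ 2 ∂m ≥
      (1 - 2 * γ * K ^ 2 * (μ + lam₀)) * ∫ x, frob (σ x) (ε x) ∂m := by
  have h : ∫ x, (frob (σ x) (κ x)) ^ 2 ∂m ≤
      ∫ x, 2 * K ^ 2 * (μ + lam₀) * frob (σ x) (ε x) ∂m := by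
    apply integral_mono_ae hint₂ (hint₁.const_mul _)
    filter_upwards [hn, hεn, hκ] with x h1 h2 h3
    exact pointwise_bound μ lam₀ K hμ hlam (n x) (ε x) (κ x) h1 h2 h3 (σ x) (hσ x)
  rw [integral_const_mul] at h
  have h' := mul_le_mul_of_nonneg_left h hγ
  linarith
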